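/- Let ℓ be a field of characteristic ≠ 2 such that ℓ satisfies property 𝒜_i(2) for some integer i ≥ 0 and u(ℓ) = 2^i. Let q be a 2^i-dimensional anisotropic quadratic form over ℓ. Then for every non-trivial discrete valuation v on ℓ(x_1, x_2) that is trivial on ℓ(x_1), the 2^{i+2}-dimensional quadratic form φ = ⟨x_2 + 1, −x_1 − x_2, x_1, x_1·x_2⟩ ⊗ q over ℓ(x_1, x_2) satisfies i_W(φ_v) ≥ 2^i, where φ_v denotes φ over the v-adic completion of ℓ(x_1, x_2). -/

import Mathlib

/-!  Diagonal quadratic forms over a field of characteristic ≠ 2.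
In characteristic ≠ 2 every regular quadratic form is isometric to a diagonal form
`⟨d 1, …, d n⟩`, so we model (regular) quadratic forms by their diagonal
coefficient functions. -/

/-- The diagonal quadratic form `⟨d i⟩_{i : ι}` over `k`. -/
noncomputable def diagQF (k : Type) [Field k] {ι : Type} [Fintype ι] (d : ι → k) :
    QuadraticForm k (ι → k) :=
  QuadraticMap.weightedSumSquares k d

/-- Isometry of (diagonal) quadratic forms. -/
def FormIsom (k : Type) [Field k] {ι κ : Type} [Fintype ι] [Fintype κ]
    (d : ι → k) (e : κ → k) : Prop :=
  QuadraticMap.Equivalent (diagQF k d) (diagQF k e)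

/-- The orthogonal sum of `m` copies of the hyperbolic plane `⟨1, -1⟩`. -/
def hypForm (k : Type) [Field k] (m : ℕ) : Fin (2 * m) → k :=
  fun j => if j.val % 2 = 0 then 1 else -1

/-- The Witt index of a (diagonal) form: the largest `m` such that the form is isometric
to `m·ℍ ⟂ (rest)` for some diagonal form `rest`. -/
noncomputable def wittIndex (k : Type) [Field k] {ι : Type} [Fintype ι] (d : ι → k) : ℕ :=
  sSup {m : ℕ | ∃ (s : ℕ) (e : Fin s → k), FormIsom k d (Sum.elim (hypForm k m) e)}
/-- The u-invariant of a field: the supremum of the dimensions of anisotropic regular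
quadratic forms over `k` (`⊤` if unbounded). -/
noncomputable def uInv (k : Type) [Field k] : ℕ∞ :=
  sSup {N : ℕ∞ | ∃ n : ℕ, N = n ∧
    ∃ d : Fin n → k, (∀ t, d t ≠ 0) ∧ (diagQF k d).Anisotropic}

/-- The refined m-invariant `m_{i,j}(k)`: the least dimension (`⊤` if there is none) of a
regular quadratic form `q` of dimension ≥ 1 over `k` with `i_W(q) < j` such that
`i_W(q ⟂ σ) ≥ j` for every `i`-dimensional regular form `σ` over `k`. -/
noncomputable def mInv (k : Type) [Field k] (i j : ℕ) : ℕ∞ :=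
  sInf {N : ℕ∞ | ∃ n : ℕ, N = n ∧ 1 ≤ n ∧
    ∃ d : Fin n → k, (∀ t, d t ≠ 0) ∧ wittIndex k d < j ∧
      ∀ σ : Fin i → k, (∀ t, σ t ≠ 0) → j ≤ wittIndex k (Sum.elim d σ)}
/-- The value group of (normalized) discrete valuations. -/
abbrev Zm0 : Type := WithZero (Multiplicative ℤ)

/-- A (discrete, i.e. `ℤₘ₀`-valued) valuation is non-trivial if it takes a value other
than 0 and 1. -/
def isNontrivialVal {k : Type} [Field k] (v : Valuation k Zm0) : Prop :=
  ∃ x : k, v x ≠ 0 ∧ v x ≠ 1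

/-- The completion `k_v` of a field `k` with respect to a discrete valuation `v`. -/
noncomputable def valCompletion {k : Type} [Field k] (v : Valuation k Zm0) : Type :=
  letI := Valued.mk' v
  UniformSpace.Completion k

noncomputable instance valCompletion.instField {k : Type} [Field k] (v : Valuation k Zm0) :
    Field (valCompletion v) :=
  letI := Valued.mk' v
  UniformSpace.Completion.instField

/-- The canonical embedding of a field into its `v`-adic completion. -/
noncomputable def toValCompletion {k : Type} [Field k] (v : Valuation k Zm0) :
    k →+* valCompletion v :=
  letI := Valued.mk' v
  UniformSpace.Completion.coeRingHom

/-- A quadratic form `q` over `k` satisfies `LGP(r, s)` with respect to a set `V` of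
discrete valuations on `k` if `i_W(q_{k_v}) ≥ r` for all `v ∈ V` implies `i_W(q) ≥ s`. -/
def satisfiesLGP {k : Type} [Field k] (V : Set (Valuation k Zm0)) {ι : Type} [Fintype ι]
    (d : ι → k) (r s : ℕ) : Prop :=
  (∀ v ∈ V, r ≤ wittIndex (valCompletion v) (toValCompletion v ∘ d)) → s ≤ wittIndex k d
/-- Property `𝒜_i(2)`: every system of `s` quadratic forms (homogeneous quadratic
polynomials) over `ℓ` in `n > s·2^i` common variables has a non-trivial simultaneous zero
in some odd degree (finite) field extension of `ℓ`. -/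
def propertyA (ℓ : Type) [Field ℓ] (i : ℕ) : Prop :=
  ∀ (s n : ℕ) (P : Fin s → MvPolynomial (Fin n) ℓ),
    (∀ t, (P t).IsHomogeneous 2) → s * 2 ^ i < n →
    ∃ (L : Type) (_ : Field L) (_ : Algebra ℓ L),
      FiniteDimensional ℓ L ∧ Odd (Module.finrank ℓ L) ∧
      ∃ x : Fin n → L, x ≠ 0 ∧ ∀ t, MvPolynomial.aeval x (P t) = 0
/-- The rational function field `k(x₁, x₂)`, modeled as the fraction field of the
polynomial ring in two variables. -/
noncomputable abbrev L2 (k : Type) [Field k] : Type :=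
  FractionRing (MvPolynomial (Fin 2) k)

/-- The variable `x_{j+1}` as an element of `k(x₁, x₂)`. -/
noncomputable def xvar (k : Type) [Field k] (j : Fin 2) : L2 k :=
  algebraMap (MvPolynomial (Fin 2) k) (L2 k) (MvPolynomial.X j)

/-- The inclusion of constants `k → k(x₁, x₂)`. -/
noncomputable def constMap (k : Type) [Field k] : k →+* L2 k :=
  (algebraMap (MvPolynomial (Fin 2) k) (L2 k)).comp (MvPolynomial.C)


open Polynomial in
theorem exists_odd_irr_factor {F : Type} [Field F] (g : F[X]) (h0 : g ≠ 0) (hodd : Odd g.natDegree) :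
    ∃ h : F[X], Irreducible h ∧ Odd h.natDegree ∧ h ∣ g := by
  revert h0 hodd
  refine WfDvdMonoid.induction_on_irreducible g ?_ ?_ ?_
  · intro h; exact absurd rfl h
  · intro u hu _ hodd
    rw [natDegree_eq_zero_of_isUnit hu] at hodd
    exact absurd hodd (by decide)
  · intro a p ha hp ih h0 hodd
    rw [natDegree_mul hp.ne_zero ha] at hodd
    by_cases h : Odd p.natDegree
    · exact ⟨p, hp, h, dvd_mul_right _ _⟩
    · obtain ⟨q, hq, hq', hd⟩ := ih ha (by
        rcases Nat.even_or_odd a.natDegree with h' | h'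
        · exfalso
          rw [Nat.not_odd_iff_even] at h
          exact (Nat.not_odd_iff_even.2 (h.add h')) hodd
        · exact h')
      exact ⟨q, hq, hq', hd.mul_left _⟩

open Polynomial in
theorem springer_poly {F : Type} [Field F] {n : ℕ} (a : Fin n → F)
    (han : ∀ x : Fin n → F, ∑ j, a j * x j ^ 2 = 0 → x = 0) :
    ∀ m : ℕ, ∀ f : F[X], Irreducible f → Odd f.natDegree → f.natDegree = m →
      ∀ d : ℕ, ∀ z : Fin n → F[X], (∀ j, (z j).natDegree ≤ d) →
      f ∣ ∑ j, C (a j) * z j ^ 2 → ∀ j, f ∣ z j := by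
  intro m
  induction m using Nat.strong_induction_on with
  | _ m ihm =>
  intro f hf hodd hm
  -- first case, small degrees
  have key : ∀ d : ℕ, d < m → ∀ z : Fin n → F[X], (∀ j, (z j).natDegree ≤ d) →
      f ∣ ∑ j, C (a j) * z j ^ 2 → ∀ j, f ∣ z j := by
    intro d
    induction d using Nat.strong_induction_on with
    | _ d ihd =>
    intro hdm z hz hdvd
    by_cases hzero : ∀ j, (z j).coeff d = 0
    · rcases Nat.eq_zero_or_pos d with rfl | hd
      · intro j
        have : z j = 0 := by
          rw [eq_C_of_natDegree_le_zero (hz j), hzero j, C_0]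
        rw [this]; exact dvd_zero _
      · refine ihd (d-1) (by omega) (by omega) z (fun j => ?_) hdvd
        have h1 := hz j
        by_contra hcon
        have h2 : (z j).natDegree = d := by omega
        have h3 := hzero j
        rw [← h2] at h3
        have h4 : z j = 0 := leadingCoeff_eq_zero.1 h3
        rw [h4] at h2; simp at h2; omega
    · have hne : ∑ j, a j * (z j).coeff d ^ 2 ≠ 0 := by
        intro h
        apply hzero
        intro j
        exact congrFun (han _ h) j
      have hcoef : (∑ j, C (a j) * z j ^ 2).coeff (2 * d) = ∑ j, a j * (z j).coeff d ^ 2 := by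
        rw [finsetSum_coeff]
        refine Finset.sum_congr rfl (fun j _ => ?_)
        rw [coeff_C_mul, coeff_pow_of_natDegree_le (hz j)]
      have hdeg : (∑ j, C (a j) * z j ^ 2).natDegree = 2 * d := by
        apply le_antisymm
        · refine natDegree_sum_le_of_forall_le _ _ (fun j _ => ?_)
          refine (natDegree_C_mul_le _ _).trans ?_
          refine natDegree_pow_le.trans ?_
          have := hz j
          omega
        · apply le_natDegree_of_ne_zero
          rw [hcoef]; exact hne
      obtain ⟨g, hg⟩ := hdvd
      have hQ0 : (∑ j, C (a j) * z j ^ 2) ≠ 0 := by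
        intro h; rw [h] at hcoef; simp at hcoef; exact hne hcoef.symm
      have hg0 : g ≠ 0 := by rintro rfl; rw [mul_zero] at hg; exact hQ0 hg
      have hdg : f.natDegree + g.natDegree = 2 * d := by
        rw [← natDegree_mul hf.ne_zero hg0, ← hg, hdeg]
      have hgodd : Odd g.natDegree := by
        obtain ⟨k, hk⟩ := hodd
        exact ⟨d - k - 1, by omega⟩
      obtain ⟨h, hirr, hhodd, hhg⟩ := exists_odd_irr_factor g hg0 hgodd
      have hle : h.natDegree ≤ g.natDegree := natDegree_le_of_dvd hhg hg0
      have hall := ihm h.natDegree (by omega) h hirr hhodd rfl d z hz (by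
        rw [hg]; exact hhg.mul_left _)
      choose z' hz' using hall
      have hndvd : ¬ f ∣ h := by
        intro hfh
        have := natDegree_le_of_dvd hfh hirr.ne_zero
        omega
      have hpos : 0 < h.natDegree := hirr.natDegree_pos
      have hd' : f ∣ ∑ j, C (a j) * z' j ^ 2 := by
        have : h ^ 2 * ∑ j, C (a j) * z' j ^ 2 = f * g := by
          rw [← hg, Finset.mul_sum]
          refine Finset.sum_congr rfl (fun j _ => ?_)
          rw [hz' j]; ring
        have h2 : f ∣ h ^ 2 * ∑ j, C (a j) * z' j ^ 2 := this ▸ dvd_mul_right _ _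
        rcases hf.prime.dvd_or_dvd h2 with h3 | h3
        · exact absurd (hf.prime.dvd_of_dvd_pow h3) hndvd
        · exact h3
      have := ihd (d-1) (by omega) (by omega) z' (fun j => ?_) hd'
      · intro j; rw [hz' j]; exact (this j).mul_left _
      · by_cases h0 : z' j = 0
        · rw [h0]; simp
        · have e1 := hz j
          rw [hz' j, natDegree_mul hirr.ne_zero h0] at e1
          omega
  intro d z hz hdvd j
  have hmpos : 0 < m := hm ▸ hf.natDegree_pos
  have := key (m-1) (by omega) (fun j => z j % f) (fun j => ?_) ?_ j
  · exact (EuclideanDomain.dvd_mod_iff dvd_rfl).1 this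
  · have : (z j % f).natDegree < f.natDegree := natDegree_mod_lt _ (by omega)
    omega
  · have e : (∑ j, C (a j) * z j ^ 2) - ∑ j, C (a j) * (z j % f) ^ 2 =
        f * ∑ j, C (a j) * ((z j / f) * (z j + z j % f)) := by
      rw [← Finset.sum_sub_distrib, Finset.mul_sum]
      refine Finset.sum_congr rfl (fun j _ => ?_)
      have := EuclideanDomain.div_add_mod (z j) f
      linear_combination (-C (a j) * (z j + z j % f)) * this
    have := dvd_sub hdvd (e ▸ dvd_mul_right f _ : f ∣ _)
    simpa using this

open Polynomial IntermediateField in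
theorem springer_odd : ∀ m : ℕ, ∀ (F E : Type) [Field F] [Field E] [Algebra F E]
    [FiniteDimensional F E], Module.finrank F E = m → Odd m → ∀ (n : ℕ) (a : Fin n → F),
    (∀ x : Fin n → F, ∑ j, a j * x j ^ 2 = 0 → x = 0) →
    ∀ x : Fin n → E, ∑ j, algebraMap F E (a j) * x j ^ 2 = 0 → x = 0 := by
  intro m
  induction m using Nat.strong_induction_on with
  | _ m ih =>
  intro F E _ _ _ _ hm hodd n a han x hx
  by_cases h1 : ∀ α : E, α ∈ (⊥ : IntermediateField F E)
  · have : ∀ α : E, ∃ c : F, algebraMap F E c = α := fun α => by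
      simpa [IntermediateField.mem_bot] using h1 α
    choose c hc using this
    have h2 : (fun j => c (x j)) = 0 := by
      apply han
      apply (algebraMap F E).injective
      rw [map_sum, map_zero, ← hx]
      refine Finset.sum_congr rfl (fun j _ => ?_)
      rw [map_mul, map_pow, hc]
    ext j
    rw [← hc (x j), show c (x j) = 0 from congrFun h2 j]; simp
  · push Not at h1
    obtain ⟨α, hα⟩ := h1
    have hint : IsIntegral F α := Algebra.IsIntegral.isIntegral α
    have hmul := Module.finrank_mul_finrank F F⟮α⟯ E
    have hfr : Module.finrank F F⟮α⟯ = (minpoly F α).natDegree := adjoin.finrank hint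
    have hne1 : Module.finrank F F⟮α⟯ ≠ 1 := by
      intro h
      rw [IntermediateField.finrank_eq_one_iff] at h
      apply hα
      rw [← h]; exact mem_adjoin_simple_self F α
    rw [hm] at hmul
    have ho := hodd
    rw [← hmul, Nat.odd_mul] at ho
    have hpos : 0 < Module.finrank F F⟮α⟯ := Module.finrank_pos
    have hpos' : 0 < Module.finrank F⟮α⟯ E := Module.finrank_pos
    have h2le : 2 ≤ Module.finrank F F⟮α⟯ := by omega
    have hlt : Module.finrank F⟮α⟯ E < m := by nlinarith
    refine ih _ hlt F⟮α⟯ E rfl ho.2 n (fun j => algebraMap F F⟮α⟯ (a j)) ?_ x ?_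
    · intro y hy
      have hz : ∀ j, ∃ p : F[X], aeval α p = (y j : E) := by
        intro j
        have := (y j).2
        rw [← IntermediateField.mem_toSubalgebra, adjoin_simple_toSubalgebra_of_isAlgebraic hint.isAlgebraic,
          Algebra.adjoin_singleton_eq_range_aeval] at this
        exact this
      choose p hp using hz
      have hd := springer_poly a han _ (minpoly F α) (minpoly.irreducible hint) (hfr ▸ ho.1) rfl
        (∑ j, (p j).natDegree) p (fun j => Finset.single_le_sum (f := fun j => (p j).natDegree)
          (fun _ _ => Nat.zero_le _) (Finset.mem_univ j)) (by
          apply minpoly.dvd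
          rw [map_sum]
          have := congrArg (algebraMap F⟮α⟯ E) hy
          rw [map_sum, map_zero] at this
          rw [← this]
          refine Finset.sum_congr rfl (fun j _ => ?_)
          rw [map_mul, map_pow, map_mul, map_pow, hp, aeval_C]
          rfl)
      ext j
      rw [← hp j]
      obtain ⟨r, hr⟩ := hd j
      rw [hr, map_mul, minpoly.aeval, zero_mul]; rfl
    · rw [← hx]
      rfl

theorem propertyA_fintype {ℓ : Type} [Field ℓ] {i : ℕ} (hA : propertyA ℓ i)
    (S N : Type) [Fintype S] [Fintype N] (P : S → MvPolynomial N ℓ)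
    (hP : ∀ t, (P t).IsHomogeneous 2) (hc : Fintype.card S * 2 ^ i < Fintype.card N) :
    ∃ (L : Type) (_ : Field L) (_ : Algebra ℓ L),
      FiniteDimensional ℓ L ∧ Odd (Module.finrank ℓ L) ∧
      ∃ x : N → L, x ≠ 0 ∧ ∀ t, MvPolynomial.aeval x (P t) = 0 := by
  obtain ⟨L, h1, h2, h3, h4, x, hx, h⟩ := hA (Fintype.card S) (Fintype.card N)
    (fun t => MvPolynomial.rename (Fintype.equivFin N) (P ((Fintype.equivFin S).symm t)))
    (fun t => (hP _).rename_isHomogeneous) hc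
  refine ⟨L, h1, h2, h3, h4, x ∘ Fintype.equivFin N, ?_, ?_⟩
  · intro h0
    apply hx
    ext k
    have := congrFun h0 ((Fintype.equivFin N).symm k)
    simpa using this
  · intro t
    have := h (Fintype.equivFin S t)
    rw [MvPolynomial.aeval_rename] at this
    simpa using this

/-- exponents bounded by N -/
noncomputable def boxN (N : ℕ) : Finset (Fin 2 →₀ ℕ) := Finset.Iic (Finsupp.equivFunOnFinite.symm fun _ => N)

theorem mem_boxN {N : ℕ} {m : Fin 2 →₀ ℕ} : m ∈ boxN N ↔ ∀ t, m t ≤ N := by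
  rw [boxN, Finset.mem_Iic]
  exact Iff.rfl

theorem card_boxN (N : ℕ) : (boxN N).card = (N + 1) ^ 2 := by
  rw [boxN, Finsupp.card_Iic]
  rw [Finset.prod_subset (Finset.subset_univ _)]
  · simp
    
  · intro x _ hx
    have : (Finsupp.equivFunOnFinite.symm (fun _ : Fin 2 => N)) x = 0 := by
      simpa using hx
    rw [this]; simp

open MvPolynomial in
/-- generic polynomial with coefficient vector `c`. -/
noncomputable def genPoly {A : Type} [CommRing A] (D : ℕ) (c : boxN D → A) : MvPolynomial (Fin 2) A :=
  ∑ b : boxN D, monomial b.1 (c b)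

open MvPolynomial in
theorem coeff_genPoly {A : Type} [CommRing A] (D : ℕ) (c : boxN D → A) (m : Fin 2 →₀ ℕ) :
    coeff m (genPoly D c) = if h : m ∈ boxN D then c ⟨m, h⟩ else 0 := by
  classical
  rw [genPoly, coeff_sum]
  simp only [coeff_monomial]
  split_ifs with h
  · rw [Finset.sum_eq_single ⟨m, h⟩]
    · simp
    · intro b _ hb
      rw [if_neg]
      intro h'; apply hb; ext1; exact h'
    · intro h'; exact absurd (Finset.mem_univ _) h'
  · apply Finset.sum_eq_zero
    intro b _
    rw [if_neg]
    rintro rfl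
    exact h b.2

open MvPolynomial in
theorem degreeOf_genPoly {A : Type} [CommRing A] (D : ℕ) (c : boxN D → A) (t : Fin 2) :
    degreeOf t (genPoly D c) ≤ D := by
  rw [← Nat.lt_succ_iff, degreeOf_lt_iff (Nat.succ_pos _)]
  intro m hm
  rw [mem_support_iff, coeff_genPoly] at hm
  split_ifs at hm with h
  · exact Nat.lt_succ_of_le (mem_boxN.1 h t)
  · exact absurd rfl hm

open MvPolynomial in
theorem iso_L2 {ℓ : Type} [Field ℓ] {i : ℕ} (hA : propertyA ℓ i) {n : ℕ} (hn : 4 * 2 ^ i < n)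
    (a : Fin n → L2 ℓ) : ∃ x : Fin n → L2 ℓ, x ≠ 0 ∧ ∑ j, a j * x j ^ 2 = 0 := by
  classical
  by_contra hcon
  push Not at hcon
  have han : ∀ x : Fin n → L2 ℓ, ∑ j, a j * x j ^ 2 = 0 → x = 0 := by
    intro x hx
    by_contra h
    exact hcon x h hx
  obtain ⟨b, hb⟩ := IsLocalization.exist_integer_multiples_of_finite
    (nonZeroDivisors (MvPolynomial (Fin 2) ℓ)) a
  choose A hA' using hb
  obtain ⟨δ, hδ⟩ : ∃ δ, ∀ j t, degreeOf t (A j) ≤ δ := by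
    refine ⟨∑ j, ∑ t, degreeOf t (A j), fun j t => ?_⟩
    refine le_trans ?_ (Finset.single_le_sum (f := fun j => ∑ t, degreeOf t (A j))
      (fun _ _ => Nat.zero_le _) (Finset.mem_univ j))
    exact (Finset.single_le_sum (f := fun t => degreeOf t (A j))
      (fun _ _ => Nat.zero_le _) (Finset.mem_univ t))
  obtain ⟨D, hD⟩ : ∃ D : ℕ, (δ + 2 * D + 1) ^ 2 * 2 ^ i < n * (D + 1) ^ 2 := by
    refine ⟨(δ + 1) ^ 2 * 2 ^ i * 4 + δ, ?_⟩
    have h1 : 1 ≤ 2 ^ i := Nat.one_le_two_pow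
    generalize 2 ^ i = T at *
    have h2 : (4 * T + 1) ≤ n := hn
    refine lt_of_lt_of_le ?_ (Nat.mul_le_mul_right _ h2)
    generalize hM : (δ + 1) ^ 2 * T * 4 + δ = M
    have h3 : 4 * (T * (δ + 1) ^ 2) ≤ M := by rw [← hM]; nlinarith
    have h4 : 4 * (T * (δ + 1) ) ≤ M := by nlinarith [Nat.zero_le (T * δ), Nat.zero_le (T * δ * δ)]
    nlinarith [Nat.mul_le_mul_right M h4]
  let N := Fin n × boxN D
  let Z : Fin n → MvPolynomial (Fin 2) (MvPolynomial N ℓ) := fun j => genPoly D fun b => X (j, b)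
  let T : MvPolynomial (Fin 2) (MvPolynomial N ℓ) := ∑ j, map C (A j) * Z j ^ 2
  have hhom : ∀ m, (coeff m T).IsHomogeneous 2 := by
    intro m
    simp only [T]
    rw [coeff_sum]
    refine IsHomogeneous.sum _ _ _ (fun j _ => ?_)
    rw [coeff_mul]
    refine IsHomogeneous.sum _ _ _ (fun p _ => ?_)
    rw [coeff_map]
    suffices hs : (coeff p.2 (Z j ^ 2)).IsHomogeneous 2 by
      have := (isHomogeneous_C N (coeff p.1 (A j))).mul hs
      rwa [zero_add] at this
    rw [pow_two, coeff_mul]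
    refine IsHomogeneous.sum _ _ _ (fun p _ => ?_)
    have : ∀ m, (coeff m (Z j)).IsHomogeneous 1 := by
      intro m
      simp only [Z]
      rw [coeff_genPoly]
      split_ifs
      · exact isHomogeneous_X _ _
      · exact isHomogeneous_zero _ _ _
    exact (this _).mul (this _)
  obtain ⟨L, _, _, _, hodd, x, hx, h⟩ := propertyA_fintype hA (boxN (δ + 2 * D)) N
    (fun m => coeff m.1 T) (fun m => hhom _) (by
      simp only [N, Fintype.card_prod, Fintype.card_coe, card_boxN, Fintype.card_fin]
      exact hD)
  let z : Fin n → MvPolynomial (Fin 2) L := fun j => genPoly D fun b => x (j, b)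
  have hzsum : ∑ j, map (algebraMap ℓ L) (A j) * z j ^ 2 = 0 := by
    have hmap : ∑ j, map (algebraMap ℓ L) (A j) * z j ^ 2 =
        map (aeval x : MvPolynomial N ℓ →ₐ[ℓ] L).toRingHom T := by
      simp only [T, map_sum, map_mul, map_pow]
      refine Finset.sum_congr rfl (fun j _ => ?_)
      have e1 : map (algebraMap ℓ L) (A j) =
          map (aeval x : MvPolynomial N ℓ →ₐ[ℓ] L).toRingHom (map C (A j)) := by
        have e0 : algebraMap ℓ L = (aeval x : MvPolynomial N ℓ →ₐ[ℓ] L).toRingHom.comp C := by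
          refine RingHom.ext (fun c => ?_)
          simp
        rw [map_map, ← e0]
      have e2 : z j = map (aeval x : MvPolynomial N ℓ →ₐ[ℓ] L).toRingHom (Z j) := by
        simp only [z, Z, genPoly, map_sum, map_monomial]
        refine Finset.sum_congr rfl (fun b _ => ?_)
        simp
      rw [e1, e2]
    ext m
    rw [coeff_zero]
    by_cases hm : m ∈ boxN (δ + 2 * D)
    · rw [hmap, coeff_map]
      exact h ⟨m, hm⟩
    · by_contra hne
      apply hm
      rw [mem_boxN]
      intro t
      refine (monomial_le_degreeOf t (mem_support_iff.2 hne)).trans ?_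
      refine (degreeOf_sum_le _ _ _).trans ?_
      refine Finset.sup_le (fun j _ => ?_)
      refine (degreeOf_mul_le _ _ _).trans ?_
      refine Nat.add_le_add ?_ ?_
      · refine le_trans ?_ (hδ j t)
        rw [degreeOf_eq_sup, degreeOf_eq_sup]
        exact Finset.sup_mono (support_map_subset _ _)
      · refine (degreeOf_pow_le _ _ _).trans ?_
        exact Nat.mul_le_mul_left _ (degreeOf_genPoly _ _ _)
  have hz0 : z ≠ 0 := by
    intro h0
    apply hx
    ext ⟨j, b⟩
    have := congrArg (coeff b.1) (congrFun h0 j)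
    simp only [z, coeff_genPoly] at this
    simpa using this
  let _ : Algebra (MvPolynomial (Fin 2) ℓ) (MvPolynomial (Fin 2) L) :=
    MvPolynomial.algebraMvPolynomial
  let _ : Algebra (L2 ℓ) (L2 L) :=
    FractionRing.liftAlgebra (MvPolynomial (Fin 2) ℓ) (FractionRing (MvPolynomial (Fin 2) L))
  have hrank : Module.finrank (L2 ℓ) (L2 L) = Module.finrank ℓ L := by
    have := Algebra.IsAlgebraic.rank_fractionRing_mvPolynomial (R := ℓ) (S := L) (Fin 2)
    have h2 := congrArg Cardinal.toNat this
    simpa [Module.finrank] using h2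
  have hfin : FiniteDimensional (L2 ℓ) (L2 L) := by
    apply Module.finite_of_finrank_pos
    rw [hrank]
    exact Module.finrank_pos
  have hbm : algebraMap (MvPolynomial (Fin 2) ℓ) (L2 ℓ) b ≠ 0 := by
    simp
  have := springer_odd _ (L2 ℓ) (L2 L) hrank hodd n a han
    (fun j => algebraMap _ (L2 L) (z j)) (by
      have hb' : algebraMap (L2 ℓ) (L2 L) (algebraMap (MvPolynomial (Fin 2) ℓ) (L2 ℓ) b) ≠ 0 := by
        simpa using hbm
      apply mul_left_cancel₀ hb'
      rw [mul_zero, ← map_zero (algebraMap (MvPolynomial (Fin 2) L) (L2 L)), ← hzsum, map_sum, Finset.mul_sum]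
      refine Finset.sum_congr rfl (fun j _ => ?_)
      rw [map_mul, map_pow, ← mul_assoc, ← map_mul]
      congr 1
      have e := hA' j
      rw [Algebra.smul_def] at e
      rw [← e, ← IsScalarTower.algebraMap_apply, IsScalarTower.algebraMap_apply _ (MvPolynomial (Fin 2) L) (L2 L)]
      rfl)
  apply hz0
  ext1 j
  have h2 := congrFun this j
  simpa using h2

theorem val_tendsto_zero {R : Type} [Field R] [Valued R Zm0] (y : R) (hy : Valued.v y < 1)
    (f : ℕ → R) (hf : ∀ n, Valued.v (f n) ≤ Valued.v y ^ n) :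
    Filter.Tendsto f Filter.atTop (nhds 0) := by
  have h := Valued.tendsto_zero_pow_of_v_lt_one hy
  rw [(Valued.hasBasis_nhds_zero R Zm0).tendsto_right_iff] at h ⊢
  intro γ _
  filter_upwards [h γ trivial] with n hn
  refine lt_of_le_of_lt ?_ hn
  rw [Valuation.restrict_le_iff, map_pow]
  exact hf n

noncomputable def newtonSeq {K : Type} [Field K] (y : K) : ℕ → K
  | 0 => 1
  | n + 1 => newtonSeq y n - (newtonSeq y n ^ 2 - (1 + y)) / (2 * newtonSeq y n)

theorem newton_bound {K : Type} [Field K] (v : Valuation K Zm0) (h2 : v 2 = 1) (y : K)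
    (hy : v y < 1) (n : ℕ) :
    v (newtonSeq y n) = 1 ∧ v (newtonSeq y n ^ 2 - (1 + y)) ≤ v y ^ (n + 1) := by
  induction n with
  | zero =>
    simp only [newtonSeq, map_one, true_and, zero_add, pow_one]
    have : (1 : K) ^ 2 - (1 + y) = - y := by ring
    rw [this, Valuation.map_neg]
  | succ n ih =>
    obtain ⟨h1, hb⟩ := ih
    simp only [newtonSeq]
    set s := newtonSeq y n
    set e := s ^ 2 - (1 + y) with he
    have hs0 : s ≠ 0 := by intro h; rw [h] at h1; simp at h1
    have h20 : (2 : K) ≠ 0 := by intro h; rw [h] at h2; simp at h2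
    have ht : v (e / (2 * s)) = v e := by simp [h1, h2]
    have hlt : v e < 1 := lt_of_le_of_lt hb (pow_lt_one₀ zero_le hy (by omega))
    constructor
    · rw [Valuation.map_sub_eq_of_lt_left, h1]
      rw [ht, h1]; exact hlt
    · have : (s - e / (2 * s)) ^ 2 - (1 + y) = (e / (2 * s)) ^ 2 := by
        have : (e / (2 * s)) * (2 * s) = e := by field_simp
        have h' : (1 + y) = s ^ 2 - e := by rw [he]; ring
        rw [h']
        linear_combination -this
      rw [this, map_pow, ht]
      calc v e ^ 2 ≤ (v y ^ (n + 1)) ^ 2 := pow_le_pow_left₀ zero_le hb 2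
        _ = v y ^ ((n + 1) * 2) := (pow_mul _ _ _).symm
        _ ≤ v y ^ (n + 1 + 1) := pow_le_pow_right_of_le_one' hy.le (by omega)

theorem sqrt_completion {K : Type} [Field K] (v : Valuation K Zm0) (h2 : v 2 = 1) (y : K)
    (hy : v y < 1) : ∃ w : valCompletion v, w ^ 2 = toValCompletion v (1 + y) := by
  let _ : Valued K Zm0 := Valued.mk' v
  have hle : ∀ n, v y ^ (n + 1) ≤ v y ^ n := fun n => pow_le_pow_right_of_le_one' hy.le (by omega)
  have hc : CauchySeq (newtonSeq y) := by
    have : NonarchimedeanRing K := v.subgroups_basis.nonarchimedean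
    refine NonarchimedeanAddGroup.cauchySeq_of_tendsto_sub_nhds_zero ?_
    refine val_tendsto_zero y hy _ (fun n => ?_)
    change v _ ≤ v y ^ n
    refine le_trans ?_ (hle n)
    obtain ⟨h1, hb⟩ := newton_bound v h2 y hy n
    refine le_trans (le_of_eq ?_) hb
    simp only [newtonSeq]
    rw [sub_sub_cancel_left, Valuation.map_neg]
    simp [h1, h2]
  have hc2 : CauchySeq (fun n => ((newtonSeq y n : K) : UniformSpace.Completion K)) :=
    hc.map (UniformSpace.Completion.uniformContinuous_coe K)
  obtain ⟨w, hw⟩ := cauchySeq_tendsto_of_complete hc2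
  refine ⟨(w : UniformSpace.Completion K), ?_⟩
  have t1 := hw.pow 2
  have t2 : Filter.Tendsto (fun n => newtonSeq y n ^ 2) Filter.atTop (nhds (1 + y)) := by
    rw [← tendsto_sub_nhds_zero_iff]
    refine val_tendsto_zero y hy _ (fun n => ?_)
    exact ((newton_bound v h2 y hy n).2).trans (hle n)
  have t3 := ((UniformSpace.Completion.continuous_coe K).tendsto _).comp t2
  change w ^ 2 = ((1 + y : K) : UniformSpace.Completion K)
  refine tendsto_nhds_unique t1 ?_
  refine t3.congr (fun n => ?_)
  exact map_pow (UniformSpace.Completion.coeRingHom : K →+* UniformSpace.Completion K) _ _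

section isomcalc
variable {k : Type} [Field k]

theorem FormIsom.rfl' {ι : Type} [Fintype ι] (d : ι → k) : FormIsom k d d :=
  QuadraticMap.Equivalent.refl _

theorem FormIsom.symm' {ι κ : Type} [Fintype ι] [Fintype κ] {d : ι → k} {e : κ → k}
    (h : FormIsom k d e) : FormIsom k e d := QuadraticMap.Equivalent.symm h

theorem FormIsom.trans' {ι κ μ : Type} [Fintype ι] [Fintype κ] [Fintype μ] {d : ι → k} {e : κ → k}
    {f : μ → k} (h : FormIsom k d e) (h' : FormIsom k e f) : FormIsom k d f :=
  QuadraticMap.Equivalent.trans h h'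

theorem diagQF_apply {ι : Type} [Fintype ι] (d : ι → k) (x : ι → k) :
    diagQF k d x = ∑ j, d j * x j ^ 2 := by
  simp [diagQF, QuadraticMap.weightedSumSquares_apply, pow_two]

theorem formIsom_of {ι κ : Type} [Fintype ι] [Fintype κ] {d : ι → k} {e : κ → k}
    (f : (ι → k) ≃ₗ[k] (κ → k)) (h : ∀ x, ∑ j, e j * f x j ^ 2 = ∑ j, d j * x j ^ 2) :
    FormIsom k d e :=
  ⟨{ f with map_app' := fun x => (diagQF_apply e _).trans ((h x).trans (diagQF_apply d x).symm) }⟩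

theorem formIsom_elim {ι κ : Type} [Fintype ι] [Fintype κ] {d : ι → k} {e : κ → k}
    (h : FormIsom k d e) :
    ∃ f : (ι → k) ≃ₗ[k] (κ → k), ∀ x, ∑ j, e j * f x j ^ 2 = ∑ j, d j * x j ^ 2 := by
  obtain ⟨f⟩ := h
  refine ⟨f.toLinearEquiv, fun x => ?_⟩
  have := f.map_app x
  rw [diagQF_apply, diagQF_apply] at this
  exact this

theorem formIsom_reindex {ι κ : Type} [Fintype ι] [Fintype κ] {d : ι → k} {e : κ → k}
    (σ : ι ≃ κ) (h : ∀ j, d j = e (σ j)) : FormIsom k d e := by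
  refine formIsom_of (LinearEquiv.funCongrLeft k k σ.symm) (fun x => ?_)
  rw [← σ.sum_comp]
  refine Finset.sum_congr rfl (fun j _ => ?_)
  simp [h, LinearEquiv.funCongrLeft_apply, LinearMap.funLeft_apply]

theorem formIsom_sum {ι κ ι' κ' : Type} [Fintype ι] [Fintype κ] [Fintype ι'] [Fintype κ']
    {d : ι → k} {e : κ → k} {d' : ι' → k} {e' : κ' → k} (h : FormIsom k d d')
    (h' : FormIsom k e e') : FormIsom k (Sum.elim d e) (Sum.elim d' e') := by
  obtain ⟨f, hf⟩ := formIsom_elim h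
  obtain ⟨g, hg⟩ := formIsom_elim h'
  refine formIsom_of ((LinearEquiv.sumArrowLequivProdArrow ι κ k k).trans
    ((LinearEquiv.prodCongr f g).trans (LinearEquiv.sumArrowLequivProdArrow ι' κ' k k).symm))
    (fun x => ?_)
  simp only [Fintype.sum_sum_type, Sum.elim_inl, Sum.elim_inr, LinearEquiv.trans_apply,
    LinearEquiv.sumArrowLequivProdArrow_symm_apply_inl,
    LinearEquiv.sumArrowLequivProdArrow_symm_apply_inr, LinearEquiv.prodCongr_apply]
  rw [hf, hg]
  rfl

/-- isometry of forms given by lists -/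
def LQ (l l' : List k) : Prop := FormIsom k l.get l'.get

theorem LQ.rfl' (l : List k) : LQ l l := FormIsom.rfl' _
theorem LQ.symm' {l l' : List k} (h : LQ l l') : LQ l' l := FormIsom.symm' h
theorem LQ.trans' {l l' l'' : List k} (h : LQ l l') (h' : LQ l' l'') : LQ l l'' :=
  FormIsom.trans' h h'

theorem formIsom_append (l l' : List k) : FormIsom k (Sum.elim l.get l'.get) (l ++ l').get := by
  refine formIsom_reindex (finSumFinEquiv.trans (finCongr (by simp))) ?_
  rintro (j | j) <;> simp

theorem formIsom_ofFn {n : ℕ} (f : Fin n → k) : FormIsom k f (List.ofFn f).get := by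
  refine formIsom_reindex (finCongr (by simp)) ?_
  intro j
  simp

theorem LQ.append {l m l' m' : List k} (h : LQ l l') (h' : LQ m m') : LQ (l ++ m) (l' ++ m') :=
  (formIsom_append l m).symm'.trans' ((formIsom_sum h h').trans' (formIsom_append l' m'))

theorem LQ.append_comm (l m : List k) : LQ (l ++ m) (m ++ l) := by
  refine (formIsom_append l m).symm'.trans' (FormIsom.trans' ?_ (formIsom_append m l))
  refine formIsom_reindex (Equiv.sumComm _ _) ?_
  rintro (j | j) <;> simp

theorem LQ.cons (a : k) {l l' : List k} (h : LQ l l') : LQ (a :: l) (a :: l') :=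
  LQ.append (l := [a]) (l' := [a]) (LQ.rfl' _) h

theorem LQ.of_perm {l l' : List k} (h : l.Perm l') : LQ l l' := by
  induction h with
  | nil => exact LQ.rfl' _
  | cons a _ ih => exact ih.cons a
  | swap a b l => exact LQ.append (LQ.append_comm [b] [a]) (LQ.rfl' l)
  | trans _ _ h1 h2 => exact h1.trans' h2

theorem LQ.sq (a : k) {c : k} (hc : c ≠ 0) (l : List k) : LQ (a * c ^ 2 :: l) (a :: l) := by
  refine LQ.append (l := [a * c ^ 2]) (l' := [a]) ?_ (LQ.rfl' l)
  refine formIsom_of (LinearEquiv.smulOfNeZero k (Fin 1 → k) c hc) (fun x => ?_)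
  simp
  ring

theorem LQ.bin (a b : k) (h : a + b ≠ 0) (l : List k) :
    LQ (a :: b :: l) ((a + b) :: (a * b * (a + b)) :: l) := by
  refine LQ.append (l := [a, b]) (l' := [a + b, a * b * (a + b)]) ?_ (LQ.rfl' l)
  let f : (Fin 2 → k) ≃ₗ[k] (Fin 2 → k) :=
    { toFun := fun x => ![(a * x 0 + b * x 1) / (a + b), (x 0 - x 1) / (a + b)]
      invFun := fun x => ![x 0 + b * x 1, x 0 - a * x 1]
      map_add' := fun x y => by
        ext j; fin_cases j <;> simp <;> ring
      map_smul' := fun x y => by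
        ext j; fin_cases j <;> simp <;> ring
      left_inv := fun x => by
        ext j; fin_cases j <;> simp <;> field_simp <;> ring
      right_inv := fun x => by
        ext j; fin_cases j <;> simp <;> field_simp <;> ring }
  refine formIsom_of f (fun x => ?_)
  change ∑ j : Fin 2, [a + b, a * b * (a + b)].get j * f x j ^ 2 = ∑ j : Fin 2, [a, b].get j * x j ^ 2
  simp only [Fin.sum_univ_two]
  simp [f]
  field_simp
  ring

theorem LQ.hyp (a : k) (ha : a ≠ 0) (h2 : (2 : k) ≠ 0) (l : List k) :
    LQ (a :: -a :: l) (1 :: -1 :: l) := by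
  refine LQ.append (l := [a, -a]) (l' := [1, -1]) ?_ (LQ.rfl' l)
  let f : (Fin 2 → k) ≃ₗ[k] (Fin 2 → k) :=
    { toFun := fun x => ![((a + 1) * x 0 + (a - 1) * x 1) / 2, ((a - 1) * x 0 + (a + 1) * x 1) / 2]
      invFun := fun x => ![((a + 1) * x 0 - (a - 1) * x 1) / (2 * a),
        ((a + 1) * x 1 - (a - 1) * x 0) / (2 * a)]
      map_add' := fun x y => by
        ext j; fin_cases j <;> simp <;> ring
      map_smul' := fun x y => by
        ext j; fin_cases j <;> simp <;> ring
      left_inv := fun x => by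
        ext j; fin_cases j <;> simp <;> field_simp <;> ring
      right_inv := fun x => by
        ext j; fin_cases j <;> simp <;> field_simp <;> ring }
  refine formIsom_of f (fun x => ?_)
  change ∑ j : Fin 2, [1, -1].get j * f x j ^ 2 = ∑ j : Fin 2, [a, -a].get j * x j ^ 2
  simp only [Fin.sum_univ_two]
  simp [f]
  field_simp
  ring

theorem LQ.hyp' (a : k) (ha : a ≠ 0) (h2 : (2 : k) ≠ 0) (l : List k) :
    LQ (-a :: a :: l) (1 :: -1 :: l) := by
  have := LQ.hyp (-a) (neg_ne_zero.2 ha) h2 l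
  rwa [neg_neg] at this

/-- m hyperbolic planes -/
def hypList (k : Type) [Field k] : ℕ → List k
  | 0 => []
  | m + 1 => 1 :: -1 :: hypList k m

theorem ofFn_hypForm (m : ℕ) : List.ofFn (hypForm k m) = hypList k m := by
  induction m with
  | zero => rfl
  | succ m ih =>
    have h : (hypForm k (m + 1)) = (hypForm k (m + 1) : Fin (2 * m + 1 + 1) → k) := rfl
    rw [h]
    change List.ofFn (n := 2 * m + 1 + 1) _ = _
    rw [List.ofFn_succ, List.ofFn_succ, hypList, ← ih]
    congr 2
    congr 1
    funext j
    simp only [hypForm, Fin.val_succ]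
    have : (j.val + 1 + 1) % 2 = j.val % 2 := by omega
    simp only [this]

theorem le_wittIndex {ι : Type} [Fintype ι] (d : ι → k) (l r : List k) (m : ℕ)
    (h1 : FormIsom k d l.get) (h2 : LQ l (hypList k m ++ r)) : m ≤ wittIndex k d := by
  refine le_csSup ?_ ?_
  · refine ⟨Fintype.card ι, ?_⟩
    rintro m' ⟨s, e, h⟩
    obtain ⟨f, -⟩ := formIsom_elim h
    have := f.finrank_eq
    simp at this
    omega
  · refine ⟨r.length, r.get, ?_⟩
    refine h1.trans' (FormIsom.trans' h2 ?_)
    refine (formIsom_append _ _).symm'.trans' (formIsom_sum ?_ (FormIsom.rfl' _))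
    rw [← ofFn_hypForm]
    exact (formIsom_ofFn _).symm'

end isomcalc

section unitforms
variable {K : Type} [Field K] (v : Valuation K Zm0)

/-- `VRep v l c p`: `c` is a value of the diagonal form `l` at an integral vector,
which is primitive if `p = true`. -/
inductive VRep : List K → K → Bool → Prop
  | nil : VRep [] 0 false
  | low {a x : K} {l : List K} {c : K} {p : Bool} : VRep l c p → v x < 1 →
      VRep (a :: l) (a * x ^ 2 + c) p
  | unit {a x : K} {l : List K} {c : K} {p : Bool} : VRep l c p → v x = 1 →
      VRep (a :: l) (a * x ^ 2 + c) true

variable {v}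

theorem val_low {a x : K} (ha : v a = 1) (hx : v x < 1) : v (a * x ^ 2) < 1 := by
  rw [map_mul, ha, one_mul, map_pow]
  exact pow_lt_one₀ zero_le hx two_ne_zero

theorem val_unit {a x : K} (ha : v a = 1) (hx : v x = 1) : v (a * x ^ 2) = 1 := by
  rw [map_mul, ha, one_mul, map_pow, hx, one_pow]

theorem VRep.le_one {l : List K} {c : K} {p : Bool} (h : VRep v l c p)
    (hl : ∀ a ∈ l, v a = 1) : v c ≤ 1 ∧ (p = false → v c < 1) := by
  induction h with
  | nil => simp
  | low h hx ih =>
    have ih := ih (fun a ha => hl a (List.mem_cons_of_mem _ ha))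
    have := val_low (hl _ List.mem_cons_self) hx
    exact ⟨v.map_add_le this.le ih.1, fun hp => v.map_add_lt this (ih.2 hp)⟩
  | unit h hx ih =>
    have ih := ih (fun a ha => hl a (List.mem_cons_of_mem _ ha))
    have := val_unit (hl _ List.mem_cons_self) hx
    exact ⟨v.map_add_le this.le ih.1, fun hp => by simp at hp⟩

/-- residually anisotropic -/
def VAniso (v : Valuation K Zm0) (l : List K) : Prop := ∀ c, VRep v l c true → ¬ v c < 1

theorem VAniso.tail {a : K} {l : List K} (h : VAniso v (a :: l)) : VAniso v l := by
  intro c hc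
  have := h (a * 0 ^ 2 + c) (VRep.low hc (by simp))
  simpa using this

theorem VAniso.eq_one {l : List K} (h : VAniso v l) (hl : ∀ a ∈ l, v a = 1) {c : K}
    (hc : VRep v l c true) : v c = 1 :=
  le_antisymm (hc.le_one hl).1 (not_lt.1 (h c hc))

theorem val_eq_one_of_sub {c d : K} (hd : v d = 1) (h : v (c - d) < 1) : v c = 1 := by
  have : c = d + (c - d) := by ring
  rw [this, Valuation.map_add_eq_of_lt_left, hd]
  rwa [hd]

theorem ne_zero_of_val {c : K} (hc : v c = 1) : c ≠ 0 := by
  rintro rfl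
  simp at hc

theorem split_value {E : Type} [Field E] (τ : K →+* E) {l : List K} {c : K} {p : Bool} (h : VRep v l c p) (hp : p = true)
    (hl : ∀ a ∈ l, v a = 1) (han : VAniso v l) :
    ∃ (d : K) (t : List K), v (d - c) < 1 ∧ v d = 1 ∧ (∀ a ∈ t, v a = 1) ∧
      t.length + 1 = l.length ∧ LQ (l.map τ) (τ d :: t.map τ) := by
  induction h with
  | nil => simp at hp
  | @low a x l c p h hx ih =>
    have hl' : ∀ a ∈ l, v a = 1 := fun a ha => hl a (List.mem_cons_of_mem _ ha)
    have ha := hl a List.mem_cons_self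
    obtain ⟨d, t, h1, h2, h3, h4, h5⟩ := ih hp hl' han.tail
    refine ⟨d, a :: t, ?_, h2, ?_, by simp [h4], ?_⟩
    · have : d - (a * x ^ 2 + c) = (d - c) - a * x ^ 2 := by ring
      rw [this]
      exact v.map_sub_lt h1 (val_low ha hx)
    · intro b hb
      rcases List.mem_cons.1 hb with rfl | hb
      · exact ha
      · exact h3 b hb
    · exact (h5.cons (τ a)).trans' (LQ.of_perm (List.Perm.swap _ _ _))
  | @unit a x l c p h hx ih =>
    have hl' : ∀ a ∈ l, v a = 1 := fun a ha => hl a (List.mem_cons_of_mem _ ha)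
    have ha := hl a List.mem_cons_self
    have hx0 : x ≠ 0 := ne_zero_of_val hx
    have hτx : τ x ≠ 0 := (map_ne_zero τ).2 hx0
    have hax := val_unit ha hx
    rcases hpp : p with _ | _
    · refine ⟨a * x ^ 2, l, ?_, hax, hl', by simp, ?_⟩
      · have : a * x ^ 2 - (a * x ^ 2 + c) = - c := by ring
        rw [this, Valuation.map_neg]
        exact (h.le_one hl').2 hpp
      · rw [map_mul, map_pow]
        exact (LQ.sq (τ a) hτx _).symm'
    · obtain ⟨d, t, h1, h2, h3, h4, h5⟩ := ih hpp hl' han.tail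
      have hc := han.eq_one hl (VRep.unit h hx)
      have hs : v (a * x ^ 2 + d) = 1 := by
        refine val_eq_one_of_sub hc ?_
        have : a * x ^ 2 + d - (a * x ^ 2 + c) = d - c := by ring
        rwa [this]
      refine ⟨a * x ^ 2 + d, (a * x ^ 2 * d * (a * x ^ 2 + d)) :: t, ?_, hs, ?_, by simp [h4], ?_⟩
      · have : a * x ^ 2 + d - (a * x ^ 2 + c) = d - c := by ring
        rwa [this]
      · intro b hb
        rcases List.mem_cons.1 hb with rfl | hb
        · rw [map_mul, map_mul, hax, h2, hs]; simp
        · exact h3 b hb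
      · refine (h5.cons (τ a)).trans' ((LQ.sq (τ a) hτx _).symm'.trans' ?_)
        have hne : τ (a * x ^ 2 + d) ≠ 0 := (map_ne_zero τ).2 (ne_zero_of_val hs)
        rw [map_add, map_mul, map_pow] at hne
        have := LQ.bin _ _ hne (t.map τ)
        simpa using this


theorem reduce_or_aniso {E : Type} [Field E] (τ : K →+* E) (h2 : (2 : E) ≠ 0)
    (hsq : ∀ y, v y < 1 → ∃ w, w ^ 2 = τ (1 + y)) (l : List K) (hl : ∀ a ∈ l, v a = 1) :
    (∃ l' : List K, (∀ a ∈ l', v a = 1) ∧ l'.length + 2 = l.length ∧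
      LQ (l.map τ) (1 :: -1 :: l'.map τ)) ∨ VAniso v l := by
  induction l with
  | nil =>
    right
    intro c hc
    cases hc
  | cons a l ih =>
    have hl' : ∀ a ∈ l, v a = 1 := fun a ha => hl a (List.mem_cons_of_mem _ ha)
    have ha := hl a List.mem_cons_self
    rcases ih hl' with ⟨l', h1, h3, h4⟩ | han
    · left
      refine ⟨a :: l', ?_, by simp [← h3], ?_⟩
      · intro b hb
        rcases List.mem_cons.1 hb with rfl | hb
        · exact ha
        · exact h1 b hb
      · refine (h4.cons (τ a)).trans' (LQ.of_perm ?_)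
        exact (List.Perm.swap _ _ _).trans ((List.Perm.swap _ _ _).cons _)
    by_cases hal : VAniso v (a :: l)
    · exact Or.inr hal
    left
    unfold VAniso at hal
    push Not at hal
    obtain ⟨c, hc, hcv⟩ := hal
    cases hc with
    | @low _ x _ c _ h hx =>
      exfalso
      refine han c h ?_
      have : c = (a * x ^ 2 + c) - a * x ^ 2 := by ring
      rw [this]
      exact v.map_sub_lt hcv (val_low ha hx)
    | @unit _ x _ c p h hx =>
      have hax := val_unit ha hx
      have hc1 : v c = 1 := by
        have h' : v (-(a * x ^ 2)) = 1 := by rw [Valuation.map_neg, hax]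
        refine val_eq_one_of_sub h' ?_
        have : c - -(a * x ^ 2) = a * x ^ 2 + c := by ring
        rwa [this]
      rcases hp : p with _ | _
      · have := (h.le_one hl').2 hp
        rw [hc1] at this
        exact absurd this (lt_irrefl _)
      obtain ⟨d, t, h1, h2', h3, h4, h5⟩ := split_value τ h hp hl' han
      refine ⟨t, h3, by simp [← h4], (h5.cons (τ a)).trans' ?_⟩
      have hax0 : a * x ^ 2 ≠ 0 := ne_zero_of_val hax
      obtain ⟨w, hw⟩ := hsq (-(a * x ^ 2 + d) / (a * x ^ 2)) (by
        rw [map_div₀, hax, div_one, Valuation.map_neg]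
        have : a * x ^ 2 + d = (a * x ^ 2 + c) + (d - c) := by ring
        rw [this]
        exact v.map_add_lt hcv h1)
      have e1 : (1 + -(a * x ^ 2 + d) / (a * x ^ 2)) * (- (a * x ^ 2)) = d := by
        have := div_mul_cancel₀ (-(a * x ^ 2 + d)) hax0
        linear_combination -this
      have e2 : τ d = (- τ a) * (w * τ x) ^ 2 := by
        rw [← e1, map_mul, ← hw]
        simp only [map_neg, map_mul, map_pow]
        ring
      have hd0 : τ d ≠ 0 := (map_ne_zero τ).2 (ne_zero_of_val h2')
      have hwx : w * τ x ≠ 0 := by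
        intro h0
        rw [e2, h0] at hd0
        simp at hd0
      rw [e2]
      refine (LQ.cons (τ a) (LQ.sq (-τ a) hwx _)).trans' ?_
      exact LQ.hyp _ ((map_ne_zero τ).2 (ne_zero_of_val ha)) h2 _

theorem vrep_ofFn {n : ℕ} (a x : Fin n → K) (hx : ∀ j, v (x j) ≤ 1) :
    ∃ p, VRep v (List.ofFn a) (∑ j, a j * x j ^ 2) p ∧ ((∃ j, v (x j) = 1) → p = true) := by
  induction n with
  | zero => exact ⟨false, by simpa using VRep.nil, by rintro ⟨j, _⟩; exact j.elim0⟩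
  | succ n ih =>
    obtain ⟨p, h1, h2⟩ := ih (fun j => a j.succ) (fun j => x j.succ) (fun j => hx _)
    rw [List.ofFn_succ, Fin.sum_univ_succ]
    rcases (hx 0).lt_or_eq with h | h
    · refine ⟨p, VRep.low h1 h, ?_⟩
      rintro ⟨j, hj⟩
      refine Fin.cases (fun hj => ?_) (fun j hj => h2 ⟨j, hj⟩) j hj
      rw [hj] at h
      exact absurd h (lt_irrefl _)
    · exact ⟨true, VRep.unit h1 h, fun _ => rfl⟩

theorem value_square {n : ℕ} (a x : Fin n → K) (ha : ∀ j, v (a j) = 1)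
    (han : VAniso v (List.ofFn a)) :
    ∃ g : K, v (∑ j, a j * x j ^ 2) = v g ^ 2 ∧ (g = 0 → x = 0) := by
  by_cases hx : x = 0
  · refine ⟨0, ?_, fun _ => hx⟩
    simp [hx]
  obtain ⟨j0, hj0⟩ := Function.ne_iff.1 hx
  have : Nonempty (Fin n) := ⟨j0⟩
  obtain ⟨j, hj⟩ := Finite.exists_max (fun j => v (x j))
  have hg : x j ≠ 0 := by
    intro h
    have := hj j0
    rw [h] at this
    simp at this
    exact hj0 this
  have hvg : v (x j) ≠ 0 := (Valuation.ne_zero_iff v).2 hg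
  refine ⟨x j, ?_, fun h => absurd h hg⟩
  obtain ⟨p, h1, h2⟩ := vrep_ofFn (v := v) a (fun k => x k / x j) (fun k => by
    rw [map_div₀]
    exact div_le_one_of_le₀ (hj k) zero_le)
  rw [h2 ⟨j, by rw [div_self hg, map_one]⟩] at h1
  have h3 := han.eq_one (by
    intro b hb
    obtain ⟨k, rfl⟩ := (List.mem_ofFn' _ _).1 hb
    exact ha k) h1
  have : ∑ k, a k * x k ^ 2 = (∑ k, a k * (x k / x j) ^ 2) * x j ^ 2 := by
    rw [Finset.sum_mul]
    refine Finset.sum_congr rfl (fun k _ => ?_)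
    field_simp
  rw [this, map_mul, h3, one_mul, map_pow]

theorem exists_nonsquare_val (hv : isNontrivialVal v) :
    ∃ π : K, v π ≠ 0 ∧ ∀ g, v π ≠ v g ^ 2 := by
  by_contra hcon
  push Not at hcon
  obtain ⟨x, hx0, hx1⟩ := hv
  have key : ∀ n : ℕ, ∀ x : K, v x ≠ 0 → (WithZero.log (v x)).natAbs = n → v x = 1 := by
    intro n
    induction n using Nat.strong_induction_on with
    | _ n ih =>
      intro x hx hn
      obtain ⟨g, hg⟩ := hcon x hx
      have hg0 : v g ≠ 0 := by
        intro h
        rw [hg, h] at hx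
        simp at hx
      have hl : WithZero.log (v x) = 2 * WithZero.log (v g) := by
        rw [hg, WithZero.log_pow]
        simp
      by_cases h0 : WithZero.log (v x) = 0
      · rw [← WithZero.exp_log hx, h0]
        rfl
      · rw [hg, ih _ ?_ g hg0 rfl, one_pow]
        omega
  exact hx1 (key _ x hx0 rfl)

end unitforms

section finalpart

theorem unit_forms {ℓ : Type} [Field ℓ] {i : ℕ} (hA : propertyA ℓ i) (v : Valuation (L2 ℓ) Zm0)
    (hv : isNontrivialVal v) {E : Type} [Field E] (τ : L2 ℓ →+* E) (h2 : (2 : E) ≠ 0)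
    (hsq : ∀ y, v y < 1 → ∃ w, w ^ 2 = τ (1 + y)) (m : ℕ) (l : List (L2 ℓ))
    (hl : ∀ a ∈ l, v a = 1) (hlen : l.length = 2 * 2 ^ i + 2 * m) :
    ∃ r, LQ (l.map τ) (hypList E m ++ r) := by
  induction m generalizing l with
  | zero => exact ⟨l.map τ, LQ.rfl' _⟩
  | succ m ih =>
    rcases reduce_or_aniso τ h2 hsq l hl with ⟨l', h1, h3, h4⟩ | han
    · obtain ⟨r, hr⟩ := ih l' h1 (by omega)
      exact ⟨r, h4.trans' ((hr.cons _).cons _)⟩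
    exfalso
    obtain ⟨π, hπ0, hπ⟩ := exists_nonsquare_val hv
    obtain ⟨n, a, rfl⟩ : ∃ (n : ℕ) (a : Fin n → L2 ℓ), l = List.ofFn a :=
      ⟨l.length, l.get, by simp⟩
    have hn : n = 2 * 2 ^ i + 2 * (m + 1) := by simpa using hlen
    have ha : ∀ j, v (a j) = 1 := fun j => hl _ ((List.mem_ofFn' _ _).2 ⟨j, rfl⟩)
    obtain ⟨x, hx, hs⟩ := iso_L2 hA (n := n + n) (by omega) (Fin.append a (fun j => π * a j))
    rw [Fin.sum_univ_add] at hs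
    simp only [Fin.append_left, Fin.append_right] at hs
    obtain ⟨g, hg, hg0⟩ := value_square (v := v) a (fun j => x (Fin.castAdd n j)) ha han
    obtain ⟨h, hh, hh0⟩ := value_square (v := v) a (fun j => x (Fin.natAdd n j)) ha han
    have e : ∑ j, a j * x (Fin.castAdd n j) ^ 2 = -(π * ∑ j, a j * x (Fin.natAdd n j) ^ 2) := by
      rw [Finset.mul_sum]
      simp only [mul_assoc] at hs
      linear_combination hs
    rw [e, Valuation.map_neg, map_mul, hh] at hg
    by_cases h0 : h = 0
    · apply hx
      have h1 := hh0 h0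
      rw [h0] at hg
      have h2 : g = 0 := by simpa using hg.symm
      have h3 := hg0 h2
      ext1 j
      refine Fin.addCases (fun j => ?_) (fun j => ?_) j
      · exact congrFun h3 j
      · exact congrFun h1 j
    · apply hπ (g / h)
      have : v h ≠ 0 := (Valuation.ne_zero_iff v).2 h0
      rw [map_div₀, div_pow, ← hg]
      field_simp

variable {E : Type} [Field E]

/-- scaled list -/
def sc (c : E) (Q : List E) : List E := Q.map (fun q => c * q)

theorem LQ.map_congr {f g : E → E} (Q : List E) (h : ∀ q ∈ Q, LQ [f q] [g q]) :
    LQ (Q.map f) (Q.map g) := by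
  induction Q with
  | nil => exact LQ.rfl' _
  | cons q Q ih =>
    exact LQ.append (h q List.mem_cons_self) (ih (fun a ha => h a (List.mem_cons_of_mem _ ha)))

theorem LQ.map_congr2 {f g f' g' : E → E} (Q : List E)
    (h : ∀ q ∈ Q, LQ [f q, g q] [f' q, g' q]) :
    LQ (Q.map f ++ Q.map g) (Q.map f' ++ Q.map g') := by
  induction Q with
  | nil => exact LQ.rfl' _
  | cons q Q ih =>
    have p : ∀ (a b : E) (l m : List E), ((a :: l) ++ (b :: m)).Perm ([a, b] ++ (l ++ m)) := by
      intro a b l m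
      simp only [List.cons_append, List.nil_append, List.perm_cons]
      exact List.perm_middle
    exact (LQ.of_perm (p _ _ _ _)).trans' ((LQ.append (h q List.mem_cons_self)
      (ih (fun a ha => h a (List.mem_cons_of_mem _ ha)))).trans' (LQ.of_perm (p _ _ _ _).symm))

theorem LQ.sc_sq (c : E) {w : E} (hw : w ≠ 0) (Q : List E) : LQ (sc (c * w ^ 2) Q) (sc c Q) := by
  refine LQ.map_congr Q (fun q _ => ?_)
  have := LQ.sq (c * q) hw []
  rwa [mul_right_comm] at this

theorem LQ.sc_hyp (c : E) (hc : c ≠ 0) (h2 : (2 : E) ≠ 0) (Q : List E) (hQ : ∀ q ∈ Q, q ≠ 0) :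
    LQ (sc c Q ++ sc (-c) Q) (hypList E Q.length) := by
  have h1 : LQ (sc c Q ++ sc (-c) Q) (Q.map (fun _ => 1) ++ Q.map (fun _ => -1)) := by
    refine LQ.map_congr2 Q (fun q hq => ?_)
    have := LQ.hyp (c * q) (mul_ne_zero hc (hQ q hq)) h2 []
    rwa [← neg_mul] at this
  refine h1.trans' (LQ.of_perm ?_)
  clear h1 hQ
  induction Q with
  | nil => exact List.Perm.refl _
  | cons q Q ih =>
    simp only [List.map_cons, List.length_cons, hypList, List.cons_append, List.perm_cons]
    exact List.perm_middle.trans (ih.cons _)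

theorem LQ.sc_bin (a b : E) (h : a + b ≠ 0) (Q : List E) (hQ : ∀ q ∈ Q, q ≠ 0) :
    LQ (sc a Q ++ sc b Q) (sc (a + b) Q ++ sc (a * b * (a + b)) Q) := by
  refine LQ.map_congr2 Q (fun q hq => ?_)
  have hq := hQ q hq
  have h1 := LQ.bin (a * q) (b * q) (by rw [← add_mul]; exact mul_ne_zero h hq) []
  refine h1.trans' ?_
  rw [← add_mul]
  refine LQ.cons _ ?_
  have := LQ.sq (a * b * (a + b) * q) hq []
  have e : a * q * (b * q) * ((a + b) * q) = a * b * (a + b) * q * q ^ 2 := by ring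
  rwa [e]

theorem sqclass {K : Type} [Field K] (v : Valuation K Zm0) (τ : K →+* E)
    (hsq : ∀ y, v y < 1 → ∃ w, w ^ 2 = τ (1 + y)) (c d y : K) (hy : v y < 1)
    (h : c = d * (1 + y)) : ∃ w, w ≠ 0 ∧ τ c = τ d * w ^ 2 := by
  obtain ⟨w, hw⟩ := hsq y hy
  refine ⟨w, ?_, by rw [h, map_mul, hw]⟩
  rintro rfl
  have : (1 + y) ≠ 0 := by
    intro h0
    have : y = -1 := by linear_combination h0
    rw [this, Valuation.map_neg, map_one] at hy
    exact lt_irrefl _ hy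
  have h3 := (map_ne_zero τ).2 this
  rw [← hw] at h3
  simp at h3

theorem wittIndex_done {m : ℕ} {ι : Type} [Fintype ι] (d : ι → E) (P Q R : List E)
    (hP : FormIsom E d P.get) (hQ : ∀ q ∈ Q, q ≠ 0) (hm : Q.length = m) (h2 : (2 : E) ≠ 0)
    (c : E) (hc : c ≠ 0)
    (h : LQ P (sc c Q ++ sc (-c) Q ++ R)) : m ≤ wittIndex E d := by
  subst hm
  exact le_wittIndex d P R _ hP (h.trans' (LQ.append (LQ.sc_hyp c hc h2 Q hQ) (LQ.rfl' R)))

theorem formIsom_four {n : ℕ} (c : Fin 4 → E) (q : Fin n → E) :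
    FormIsom E (fun p : Fin 4 × Fin n => c p.1 * q p.2)
      ((sc (c 0) (List.ofFn q) ++ sc (c 1) (List.ofFn q)) ++
        (sc (c 2) (List.ofFn q) ++ sc (c 3) (List.ofFn q))).get := by
  have h1 : ∀ x : E, sc x (List.ofFn q) = List.ofFn (fun j => x * q j) := by
    intro x
    simp [sc, List.map_ofFn, Function.comp_def]
  let e : Fin 4 × Fin n ≃ (Fin n ⊕ Fin n) ⊕ (Fin n ⊕ Fin n) :=
    { toFun := fun p => match p with
        | (0, j) => Sum.inl (Sum.inl j)
        | (1, j) => Sum.inl (Sum.inr j)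
        | (2, j) => Sum.inr (Sum.inl j)
        | (3, j) => Sum.inr (Sum.inr j)
      invFun := fun s => match s with
        | Sum.inl (Sum.inl j) => (0, j)
        | Sum.inl (Sum.inr j) => (1, j)
        | Sum.inr (Sum.inl j) => (2, j)
        | Sum.inr (Sum.inr j) => (3, j)
      left_inv := by
        rintro ⟨t, j⟩
        fin_cases t <;> rfl
      right_inv := by
        rintro ((j | j) | (j | j)) <;> rfl }
  have h3 : ∀ x : E, FormIsom E (fun j => x * q j) (sc x (List.ofFn q)).get := by
    intro x
    rw [h1]
    exact formIsom_ofFn _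
  refine FormIsom.trans' (formIsom_reindex (e := Sum.elim
    (Sum.elim (fun j => c 0 * q j) (fun j => c 1 * q j))
    (Sum.elim (fun j => c 2 * q j) (fun j => c 3 * q j))) e ?_) ?_
  · rintro ⟨t, j⟩
    fin_cases t <;> rfl
  · refine (formIsom_sum (formIsom_sum (h3 _) (h3 _)) (formIsom_sum (h3 _) (h3 _))).trans' ?_
    exact (formIsom_sum (formIsom_append _ _) (formIsom_append _ _)).trans' (formIsom_append _ _)

end finalpart

/-- **Lemma (local isotropy).**  Let `ℓ` be a field of characteristic ≠ 2 with
`ℓ ∈ 𝒜_i(2)` for some `i ≥ 0` and `u(ℓ) = 2^i`.  Let `q` be a `2^i`-dimensional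
anisotropic quadratic form over `ℓ`.  Then for every non-trivial discrete valuation `v`
on `ℓ(x₁, x₂)` that is trivial on `ℓ(x₁)`, the `2^{i+2}`-dimensional form
`φ = ⟨x₂ + 1, -x₁ - x₂, x₁, x₁x₂⟩ ⊗ q` over `ℓ(x₁, x₂)` satisfies `i_W(φ_v) ≥ 2^i`. -/
theorem statement2 (ℓ : Type) [Field ℓ] (hchar : ringChar ℓ ≠ 2)
    (i : ℕ) (hA : propertyA ℓ i) (hu : uInv ℓ = ((2 ^ i : ℕ) : ℕ∞))
    (q : Fin (2 ^ i) → ℓ) (hq : (diagQF ℓ q).Anisotropic)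
    (v : Valuation (L2 ℓ) Zm0) (hv : isNontrivialVal v)
    (htriv : ∀ p : Polynomial ℓ, p ≠ 0 →
      v (Polynomial.eval₂ (constMap ℓ) (xvar ℓ 0) p) = 1) :
    2 ^ i ≤ wittIndex (valCompletion v)
      (toValCompletion v ∘ fun p : Fin 4 × Fin (2 ^ i) =>
        ![xvar ℓ 1 + 1, -xvar ℓ 0 - xvar ℓ 1, xvar ℓ 0, xvar ℓ 0 * xvar ℓ 1] p.1 *
          constMap ℓ (q p.2)) := by
  classical
  have hsc : ∀ c : ℓ, c ≠ 0 → v (constMap ℓ c) = 1 := by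
    intro c hc
    have := htriv (Polynomial.C c) (by simpa using hc)
    simpa using this
  have hx1 : v (xvar ℓ 0) = 1 := by
    have := htriv Polynomial.X Polynomial.X_ne_zero
    simpa using this
  have hx1' : v (1 - xvar ℓ 0) = 1 := by
    have := htriv (1 - Polynomial.X) (by
      intro h
      have := congrArg (Polynomial.eval 0) h
      simp at this)
    simpa using this
  have h2ℓ : (2 : ℓ) ≠ 0 := Ring.two_ne_zero hchar
  have hv2 : v 2 = 1 := by
    have := hsc 2 h2ℓ
    rwa [map_ofNat] at this
  have hq0 : ∀ j, q j ≠ 0 := by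
    intro j hj
    have := hq (Pi.single j 1) (by
      rw [diagQF_apply, Finset.sum_eq_single j]
      · simp [hj]
      · intro b _ hb
        simp [hb]
      · simp)
    have h3 := congrFun this j
    simp at h3
  have hsq := fun y (hy : v y < 1) => sqrt_completion v hv2 y hy
  have h2E : (2 : valCompletion v) ≠ 0 := by
    have : (2 : L2 ℓ) ≠ 0 := ne_zero_of_val hv2
    have := (map_ne_zero (toValCompletion v)).2 this
    rwa [map_ofNat] at this
  set τ := toValCompletion v with hτ
  set X := xvar ℓ 0 with hX
  set Y := xvar ℓ 1 with hY
  have hX0 : X ≠ 0 := ne_zero_of_val hx1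
  have hX0' : 1 - X ≠ 0 := ne_zero_of_val hx1'
  have hτX : τ X ≠ 0 := (map_ne_zero τ).2 hX0
  set Q : List (valCompletion v) := List.ofFn (fun j => τ (constMap ℓ (q j))) with hQd
  have hQ : ∀ a ∈ Q, a ≠ 0 := by
    intro a ha
    obtain ⟨j, rfl⟩ := (List.mem_ofFn' _ _).1 ha
    exact (map_ne_zero τ).2 (ne_zero_of_val (hsc _ (hq0 j)))
  have hQl : Q.length = 2 ^ i := by simp [Q]
  have hF := formIsom_four (fun t => τ (![Y + 1, -X - Y, X, X * Y] t))
    (fun j => τ (constMap ℓ (q j)))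
  have hF' : FormIsom (valCompletion v) (τ ∘ fun p : Fin 4 × Fin (2 ^ i) =>
        ![Y + 1, -X - Y, X, X * Y] p.1 * constMap ℓ (q p.2))
      ((sc (τ (Y + 1)) Q ++ sc (τ (-X - Y)) Q) ++ (sc (τ X) Q ++ sc (τ (X * Y)) Q)).get := by
    have hfun : (τ ∘ fun p : Fin 4 × Fin (2 ^ i) =>
        ![Y + 1, -X - Y, X, X * Y] p.1 * constMap ℓ (q p.2)) =
        fun p => τ (![Y + 1, -X - Y, X, X * Y] p.1) * τ (constMap ℓ (q p.2)) := by
      funext p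
      exact map_mul τ _ _
    rw [hfun]
    exact hF
  clear hF
  generalize hd : (τ ∘ fun p : Fin 4 × Fin (2 ^ i) =>
        ![Y + 1, -X - Y, X, X * Y] p.1 * constMap ℓ (q p.2)) = d at hF' ⊢
  set A := sc (τ (Y + 1)) Q with hAd
  set B := sc (τ (-X - Y)) Q with hBd
  set C := sc (τ X) Q with hCd
  set D := sc (τ (X * Y)) Q with hDd
  have perm1 : ((A ++ B) ++ (C ++ D)).Perm ((C ++ B) ++ (A ++ D)) := by
    rw [← Multiset.coe_eq_coe]
    simp only [← Multiset.coe_add]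
    abel
  have perm2 : ((A ++ B) ++ (C ++ D)).Perm ((C ++ D) ++ (A ++ B)) := List.perm_append_comm
  have perm3 : ((A ++ B) ++ (C ++ D)).Perm ((A ++ C) ++ (D ++ B)) := by
    rw [← Multiset.coe_eq_coe]
    simp only [← Multiset.coe_add]
    abel
  -- case 1
  by_cases c1 : v Y < 1
  · obtain ⟨w, hw, e⟩ := sqclass v τ hsq (-X - Y) (-X) (Y / X)
      (by rw [map_div₀, hx1, div_one]; exact c1) (by field_simp; ring)
    refine wittIndex_done d _ Q (A ++ D) hF' hQ hQl h2E (τ X) hτX ?_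
    refine (LQ.of_perm perm1).trans' (LQ.append (LQ.append (LQ.rfl' _) ?_) (LQ.rfl' _))
    rw [hBd, e, map_neg]
    exact LQ.sc_sq _ hw Q
  -- case 2
  by_cases c2 : 1 < v Y
  · have hY0 : Y ≠ 0 := by
      intro h
      rw [h] at c2
      simp at c2
    have hYi : (v Y)⁻¹ < 1 := inv_lt_one_of_one_lt₀ c2
    obtain ⟨w, hw, e⟩ := sqclass v τ hsq (Y + 1) Y (1 / Y)
      (by rw [map_div₀, map_one, one_div]; exact hYi) (by field_simp)
    obtain ⟨w', hw', e'⟩ := sqclass v τ hsq (-X - Y) (-Y) (X / Y)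
      (by rw [map_div₀, hx1, one_div]; exact hYi) (by field_simp; ring)
    refine wittIndex_done d _ Q (C ++ D) hF' hQ hQl h2E (τ Y) ((map_ne_zero τ).2 hY0) ?_
    refine LQ.append (LQ.append ?_ ?_) (LQ.rfl' _)
    · rw [hAd, e]
      exact LQ.sc_sq _ hw Q
    · rw [hBd, e', map_neg]
      exact LQ.sc_sq _ hw' Q
  -- case 3
  by_cases c3 : v (Y + 1) < 1
  · obtain ⟨w, hw, e⟩ := sqclass v τ hsq (X * Y) (-X) (-(Y + 1))
      (by rw [Valuation.map_neg]; exact c3) (by ring)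
    refine wittIndex_done d _ Q (A ++ B) hF' hQ hQl h2E (τ X) hτX ?_
    refine (LQ.of_perm perm2).trans' (LQ.append (LQ.append (LQ.rfl' _) ?_) (LQ.rfl' _))
    rw [hDd, e, map_neg]
    exact LQ.sc_sq _ hw Q
  -- case 4
  by_cases c4 : v (X + Y) < 1
  · obtain ⟨w, hw, e⟩ := sqclass v τ hsq (Y + 1) (1 - X) ((X + Y) / (1 - X))
      (by rw [map_div₀, hx1', div_one]; exact c4) (by field_simp; ring)
    obtain ⟨w', hw', e'⟩ := sqclass v τ hsq (X * Y) (-X ^ 2) (-((X + Y) / X))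
      (by rw [Valuation.map_neg, map_div₀, hx1, div_one]; exact c4) (by field_simp; ring)
    refine wittIndex_done d _ Q (sc (τ (1 - X) * τ X * (τ (1 - X) + τ X)) Q ++ B)
      hF' hQ hQl h2E 1 one_ne_zero ?_
    have s1 : τ (1 - X) + τ X = 1 := by
      rw [← map_add, sub_add_cancel, map_one]
    have h1 : LQ (A ++ C) (sc 1 Q ++ sc (τ (1 - X) * τ X * (τ (1 - X) + τ X)) Q) := by
      have hA1 : LQ A (sc (τ (1 - X)) Q) := by
        rw [hAd, e]
        exact LQ.sc_sq _ hw Q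
      refine (LQ.append hA1 (LQ.rfl' C)).trans' ?_
      have := LQ.sc_bin (τ (1 - X)) (τ X) (by rw [s1]; exact one_ne_zero) Q hQ
      rwa [s1] at this ⊢
    have h3 : LQ D (sc (-1) Q) := by
      have e2 : τ (X * Y) = (-1) * (τ X * w') ^ 2 := by
        rw [e', map_neg, map_pow]
        ring
      rw [hDd, e2]
      exact LQ.sc_sq _ (mul_ne_zero hτX hw') Q
    refine (LQ.of_perm perm3).trans' ((LQ.append h1 (LQ.append h3 (LQ.rfl' B))).trans'
      (LQ.of_perm ?_))
    rw [← Multiset.coe_eq_coe]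
    simp only [← Multiset.coe_add]
    abel
  -- case 5
  have vY : v Y = 1 := le_antisymm (not_lt.1 c2) (not_lt.1 c1)
  have vA : v (Y + 1) = 1 :=
    le_antisymm (v.map_add_le vY.le (by rw [map_one])) (not_lt.1 c3)
  have vB : v (-X - Y) = 1 := by
    have : -X - Y = -(X + Y) := by ring
    rw [this, Valuation.map_neg]
    exact le_antisymm (v.map_add_le hx1.le vY.le) (not_lt.1 c4)
  have vD : v (X * Y) = 1 := by rw [map_mul, hx1, vY, one_mul]
  let Q0 : List (L2 ℓ) := List.ofFn (fun j => constMap ℓ (q j))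
  have hQ0 : ∀ c, v c = 1 → ∀ a ∈ sc c Q0, v a = 1 := by
    intro c hc a ha
    obtain ⟨b, hb, rfl⟩ := List.mem_map.1 ha
    obtain ⟨j, rfl⟩ := (List.mem_ofFn' _ _).1 hb
    rw [map_mul, hc, hsc _ (hq0 j), one_mul]
  have hmap : ∀ c, sc (τ c) Q = (sc c Q0).map τ := by
    intro c
    simp [sc, Q, Q0, List.map_ofFn, Function.comp_def]
  obtain ⟨r, hr⟩ := unit_forms hA v hv τ h2E hsq (2 ^ i)
    ((sc (Y + 1) Q0 ++ sc (-X - Y) Q0) ++ (sc X Q0 ++ sc (X * Y) Q0)) (by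
      intro a ha
      simp only [List.mem_append] at ha
      rcases ha with (ha | ha) | (ha | ha)
      · exact hQ0 _ vA a ha
      · exact hQ0 _ vB a ha
      · exact hQ0 _ hx1 a ha
      · exact hQ0 _ vD a ha) (by
      simp [sc, Q0]
      omega)
  refine le_wittIndex d _ r _ hF' ?_
  rw [List.map_append, List.map_append, List.map_append, ← hmap, ← hmap, ← hmap, ← hmap] at hr
  exact hr
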